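/- If G is (Q,S,R)-dissipative-in-expectation and Q is negative definite, then G is input-output stable-in-expectation; that is, there exist β ∈ ℝ and γ > 0 such that for every input u : ℕ → ℝ^n and every T ∈ ℕ, E_{ω∼ℙ}[ Σ_{k=0}^{T} ‖(G(u,ω))(k)‖² ] ≤ γ · Σ_{k=0}^{T} ‖u(k)‖² + β. -/

import Mathlib

open MeasureTheory Matrix Finset

/-- A continuous function that is homogeneous of degree two is bounded above by a multiple of the
squared Euclidean norm, and the multiple is negative if the function is negative away from zero. -/
theorem exists_le_mul_dotProduct_self_of_homogeneous {n : ℕ} {f : (Fin n → ℝ) → ℝ}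
    (hf : Continuous f) (hhom : ∀ (t : ℝ) (x : Fin n → ℝ), f (t • x) = t ^ 2 * f x) :
    ∃ c : ℝ, (∀ x, f x ≤ c * (x ⬝ᵥ x)) ∧ ((∀ x, x ≠ 0 → f x < 0) → c < 0) := by
  have hzero : f 0 = 0 := by simpa using hhom 0 0
  have hclosed : IsClosed {x : Fin n → ℝ | x ⬝ᵥ x = 1} :=
    isClosed_eq (by fun_prop) continuous_const
  have hcompact : IsCompact {x : Fin n → ℝ | x ⬝ᵥ x = 1} := by
    refine (isCompact_closedBall (0 : Fin n → ℝ) 1).of_isClosed_subset hclosed fun x hx => ?_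
    rw [mem_closedBall_zero_iff, pi_norm_le_iff_of_nonneg zero_le_one]
    intro i
    have hle : x i * x i ≤ x ⬝ᵥ x :=
      Finset.single_le_sum (f := fun j => x j * x j) (fun j _ => mul_self_nonneg _)
        (Finset.mem_univ i)
    rw [Set.mem_ofPred_eq] at hx
    rw [Real.norm_eq_abs, abs_le_one_iff_mul_self_le_one]
    linarith
  have hpos : ∀ x : Fin n → ℝ, x ≠ 0 → 0 < x ⬝ᵥ x := fun x hx =>
    lt_of_le_of_ne (Finset.sum_nonneg fun i _ => mul_self_nonneg (x i))
      fun h => hx (dotProduct_self_eq_zero.mp h.symm)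
  have hscale : ∀ x : Fin n → ℝ, x ≠ 0 →
      ((√(x ⬝ᵥ x))⁻¹ • x) ⬝ᵥ ((√(x ⬝ᵥ x))⁻¹ • x) = 1 := fun x hx => by
    have h := hpos x hx
    rw [smul_dotProduct, dotProduct_smul, smul_eq_mul, smul_eq_mul, ← mul_assoc, ← mul_inv,
      Real.mul_self_sqrt h.le, inv_mul_cancel₀ h.ne']
  rcases Set.eq_empty_or_nonempty {x : Fin n → ℝ | x ⬝ᵥ x = 1} with hempty | hne
  · refine ⟨-1, fun x => ?_, fun _ => by norm_num⟩
    by_cases hx : x = 0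
    · simp [hx, hzero]
    · exact absurd (hscale x hx) fun h => (Set.eq_empty_iff_forall_notMem.mp hempty) _ h
  · obtain ⟨z, hz, hmax⟩ := hcompact.exists_isMaxOn hne hf.continuousOn
    refine ⟨f z, fun x => ?_, fun hneg => hneg z ?_⟩
    · by_cases hx : x = 0
      · simp [hx, hzero]
      · have h := hmax (hscale x hx)
        rw [Set.mem_ofPred_eq, hhom, inv_pow, Real.sq_sqrt (hpos x hx).le] at h
        rwa [inv_mul_le_iff₀ (hpos x hx), mul_comm] at h
    · rintro rfl
      simp at hz

/-- If `Q` is negative definite, the supply rate is bounded above by a negative multiple of the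
squared output norm plus a multiple of the squared input norm. -/
theorem exists_supply_rate_le {n m : ℕ} (Q : Matrix (Fin m) (Fin m) ℝ)
    (S : Matrix (Fin m) (Fin n) ℝ) (R : Matrix (Fin n) (Fin n) ℝ)
    (hQ : ∀ x : Fin m → ℝ, x ≠ 0 → x ⬝ᵥ Q *ᵥ x < 0) :
    ∃ c C : ℝ, 0 < c ∧ 0 < C ∧ ∀ (y : Fin m → ℝ) (v : Fin n → ℝ),
      y ⬝ᵥ Q *ᵥ y + 2 * (y ⬝ᵥ S *ᵥ v) + v ⬝ᵥ R *ᵥ v ≤ C * (v ⬝ᵥ v) - c * (y ⬝ᵥ y) := by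
  obtain ⟨q, hq, hqneg⟩ := exists_le_mul_dotProduct_self_of_homogeneous
    (f := fun y => y ⬝ᵥ Q *ᵥ y) (by fun_prop)
    (fun t x => by simp only [mulVec_smul, smul_dotProduct, dotProduct_smul, smul_eq_mul]; ring)
  obtain ⟨s, hs, -⟩ := exists_le_mul_dotProduct_self_of_homogeneous
    (f := fun v => (S *ᵥ v) ⬝ᵥ (S *ᵥ v)) (by fun_prop)
    (fun t x => by simp only [mulVec_smul, smul_dotProduct, dotProduct_smul, smul_eq_mul]; ring)
  obtain ⟨r, hr, -⟩ := exists_le_mul_dotProduct_self_of_homogeneous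
    (f := fun v => v ⬝ᵥ R *ᵥ v) (by fun_prop)
    (fun t x => by simp only [mulVec_smul, smul_dotProduct, dotProduct_smul, smul_eq_mul]; ring)
  obtain ⟨c, hc, rfl⟩ : ∃ c : ℝ, 0 < c ∧ q = -(2 * c) :=
    ⟨-q / 2, by linarith [hqneg hQ], by ring⟩
  refine ⟨c, |c⁻¹ * s + r| + 1, hc, by positivity, fun y v => ?_⟩
  have hyoung : 2 * (y ⬝ᵥ S *ᵥ v) ≤ c * (y ⬝ᵥ y) + c⁻¹ * ((S *ᵥ v) ⬝ᵥ (S *ᵥ v)) := by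
    simp only [dotProduct, Finset.mul_sum, ← Finset.sum_add_distrib]
    refine Finset.sum_le_sum fun i _ => ?_
    have h : 0 ≤ c⁻¹ * (c * y i - (S *ᵥ v) i) ^ 2 := by positivity
    have heq : c⁻¹ * (c * y i - (S *ᵥ v) i) ^ 2 = c * (y i * y i)
        + c⁻¹ * ((S *ᵥ v) i * (S *ᵥ v) i) - 2 * (y i * (S *ᵥ v) i) := by
      field_simp
      ring
    linarith
  have hinput : (c⁻¹ * s + r) * (v ⬝ᵥ v) ≤ (|c⁻¹ * s + r| + 1) * (v ⬝ᵥ v) :=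
    mul_le_mul_of_nonneg_right (by linarith [le_abs_self (c⁻¹ * s + r)])
      (Finset.sum_nonneg fun i _ => mul_self_nonneg (v i))
  have hcross := mul_le_mul_of_nonneg_left (hs v) (inv_pos.mpr hc).le
  linarith [hq y, hr v]

/-- If the stochastic operator `G` is `(Q,S,R)`-dissipative-in-expectation
and `Q` is negative definite, then `G` is input-output stable-in-expectation. -/
theorem stochastic_dissipative_implies_io_stable
    {n m : ℕ} {Ω : Type*} [MeasurableSpace Ω]
    (ℙ : Measure Ω) [IsProbabilityMeasure ℙ]
    (G : (ℕ → Fin n → ℝ) → Ω → ℕ → Fin m → ℝ)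
    (Q : Matrix (Fin m) (Fin m) ℝ) (S : Matrix (Fin m) (Fin n) ℝ)
    (R : Matrix (Fin n) (Fin n) ℝ)
    (hQsymm : Q.IsSymm) (hRsymm : R.IsSymm)
    -- all expectations appearing are assumed to exist
    (hIntSupply : ∀ (T : ℕ) (u : ℕ → Fin n → ℝ),
      Integrable (fun ω => ∑ k ∈ Finset.range (T + 1),
        ((G u ω k) ⬝ᵥ Q *ᵥ (G u ω k) + 2 * ((G u ω k) ⬝ᵥ S *ᵥ (u k))
          + (u k) ⬝ᵥ R *ᵥ (u k))) ℙ)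
    (hIntNorm : ∀ (T : ℕ) (u : ℕ → Fin n → ℝ),
      Integrable (fun ω => ∑ k ∈ Finset.range (T + 1), (G u ω k) ⬝ᵥ (G u ω k)) ℙ)
    -- `Q` is negative definite
    (hQneg : ∀ x : Fin m → ℝ, x ≠ 0 → x ⬝ᵥ Q *ᵥ x < 0)
    -- `G` is (Q,S,R)-dissipative-in-expectation
    (hdiss : ∃ β : ℝ, ∀ (T : ℕ) (u : ℕ → Fin n → ℝ),
      β ≤ ∫ ω, (∑ k ∈ Finset.range (T + 1),
        ((G u ω k) ⬝ᵥ Q *ᵥ (G u ω k) + 2 * ((G u ω k) ⬝ᵥ S *ᵥ (u k))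
          + (u k) ⬝ᵥ R *ᵥ (u k))) ∂ℙ) :
    -- then `G` is input-output stable-in-expectation
    ∃ (β : ℝ) (γ : ℝ), 0 < γ ∧ ∀ (u : ℕ → Fin n → ℝ) (T : ℕ),
      (∫ ω, (∑ k ∈ Finset.range (T + 1), (G u ω k) ⬝ᵥ (G u ω k)) ∂ℙ)
        ≤ γ * (∑ k ∈ Finset.range (T + 1), (u k) ⬝ᵥ (u k)) + β := by
  obtain ⟨β, hβ⟩ := hdiss
  obtain ⟨c, C, hc, hC, hsupply⟩ := exists_supply_rate_le Q S R hQneg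
  refine ⟨-β / c, C / c, by positivity, fun u T => ?_⟩
  have hle := (hβ T u).trans <| integral_mono (hIntSupply T u)
    ((integrable_const (C * ∑ k ∈ Finset.range (T + 1), u k ⬝ᵥ u k)).sub
      ((hIntNorm T u).const_mul c))
    fun ω => by
      simp only [Pi.sub_apply, Finset.mul_sum, ← Finset.sum_sub_distrib]
      exact Finset.sum_le_sum fun k _ => hsupply (G u ω k) (u k)
  simp only [Pi.sub_apply] at hle
  rw [integral_sub (integrable_const _) ((hIntNorm T u).const_mul c)] at hle
  simp only [integral_const_mul, integral_const, probReal_univ, one_smul] at hle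
  rw [div_mul_eq_mul_div, ← add_div, le_div_iff₀ hc]
  linarith
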